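/- arXiv:1207.6203 — 2 statements merged into one kernel-verified Lean document; each statement's English description precedes it below -/
import Mathlib

section
/- Under the standing assumptions (tail condition with exponent α>1, moment dominance lim m_n/μ_n = 0, and condensation condition γ(β)>0), for every x>0 the fitness distributions of Kingman's model satisfy lim_{n→∞} p_n((1 - x/n, 1)) = (γ(β)/Γ(α)) ∫_0^x y^{α-1} e^{-y} dy; i.e. rescaled by a factor n at the right endpoint, the mass forming the condensate has the shape of a gamma distribution with shape parameter α and total mass γ(β). -/
open MeasureTheory Filter Topology

lemma km_H1 (a μ : ℕ → ℝ) (D : ℝ) (G : ℕ → ℕ → ℝ) (l : ℝ)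
    (ha : ∀ n, 0 ≤ a n) (hsa : Summable a) (hμ : ∀ n, 0 < μ n)
    (hD : ∀ n k, 2 * k ≤ n → μ (n - k) ≤ D * μ n)
    (hG0 : ∀ n i, 0 ≤ G n i) (hGμ : ∀ n i, G n i ≤ μ i)
    (hl : ∀ j, Tendsto (fun n => G n (n - j) / μ n) atTop (𝓝 l)) :
    Tendsto (fun n => ∑ j ∈ Finset.range (n + 1),
      if 2 * j < n then G n (n - j) * a j / μ n else 0) atTop (𝓝 (l * ∑' j, a j)) := by
  have h := tendsto_tsum_of_dominated_convergence (𝓕 := atTop)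
    (f := fun n j => if 2 * j < n then G n (n - j) * a j / μ n else 0)
    (g := fun j => l * a j) (bound := fun j => D * a j) (hsa.mul_left D) ?_ ?_
  · rw [tsum_mul_left] at h
    refine h.congr fun n => ?_
    apply tsum_eq_sum
    intro j hj
    simp only [Finset.mem_range] at hj
    rw [if_neg (by omega)]
  · intro j
    have := (hl j).mul_const (a j)
    refine this.congr' ?_
    filter_upwards [eventually_gt_atTop (2 * j)] with n hn
    rw [if_pos hn]; ring
  · refine Eventually.of_forall fun n j => ?_
    split_ifs with hj
    · rw [Real.norm_of_nonneg (div_nonneg (mul_nonneg (hG0 _ _) (ha _)) (hμ n).le),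
        div_le_iff₀ (hμ n)]
      have := (hGμ n (n - j)).trans (hD n j hj.le)
      nlinarith [mul_le_mul_of_nonneg_right this (ha j)]
    · have h1 := hD 0 0 (by simp)
      have : 0 ≤ D := by
        by_contra hc
        push Not at hc
        have := hμ 0
        simp at h1
        nlinarith
      simpa using mul_nonneg this (ha j)

lemma km_H2 (b μ : ℕ → ℝ) (B D : ℝ) (G : ℕ → ℕ → ℝ) (h : ℕ → ℝ)
    (hb : ∀ n, 0 ≤ b n) (hbB : ∀ n, b n ≤ B) (hμ : ∀ n, 0 < μ n) (hsμ : Summable μ)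
    (hD : ∀ n k, 2 * k ≤ n → μ (n - k) ≤ D * μ n)
    (hr : ∀ k, Tendsto (fun n => μ (n - k) / μ n) atTop (𝓝 1))
    (hG0 : ∀ n i, 0 ≤ G n i) (hGμ : ∀ n i, G n i ≤ μ i)
    (hh : ∀ i, Tendsto (fun n => G n i * b (n - i)) atTop (𝓝 (h i))) :
    Tendsto (fun n => ∑ i ∈ Finset.range (n + 1),
      if 2 * i ≤ n then G n i * (b (n - i) * μ (n - i)) / μ n else 0) atTop (𝓝 (∑' i, h i)) := by
  have hD0 : 0 ≤ D := by
    have h1 := hD 0 0 (by simp)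
    by_contra hc
    push Not at hc
    have := hμ 0
    simp at h1
    nlinarith
  have hB0 : 0 ≤ B := (hb 0).trans (hbB 0)
  have h := tendsto_tsum_of_dominated_convergence (𝓕 := atTop)
    (f := fun n i => if 2 * i ≤ n then G n i * (b (n - i) * μ (n - i)) / μ n else 0)
    (g := h) (bound := fun i => (B * D) * μ i) (hsμ.mul_left _) ?_ ?_
  · refine h.congr fun n => ?_
    apply tsum_eq_sum
    intro j hj
    simp only [Finset.mem_range] at hj
    rw [if_neg (by omega)]
  · intro j
    have := (hh j).mul (hr j)
    rw [mul_one] at this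
    refine this.congr' ?_
    filter_upwards [eventually_ge_atTop (2 * j)] with n hn
    rw [if_pos hn]; ring
  · refine Eventually.of_forall fun n j => ?_
    split_ifs with hj
    · rw [Real.norm_of_nonneg (div_nonneg (mul_nonneg (hG0 _ _)
        (mul_nonneg (hb _) (hμ _).le)) (hμ n).le), div_le_iff₀ (hμ n)]
      calc G n j * (b (n - j) * μ (n - j)) ≤ μ j * (B * (D * μ n)) := by
            gcongr
            · exact mul_nonneg (hb _) (hμ _).le
            · exact (hμ _).le
            · exact hGμ _ _
            · exact (hμ _).le
            · exact hbB _
            · exact hD n j hj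
        _ = _ := by ring
    · simpa using mul_nonneg (mul_nonneg hB0 hD0) (hμ j).le

lemma km_split (n : ℕ) (g a : ℕ → ℝ) (c : ℝ) (ha0 : a 0 = 0) :
    (∑ i ∈ Finset.range n, g i * a (n - i)) / c =
      (∑ i ∈ Finset.range (n + 1), if 2 * i ≤ n then g i * a (n - i) / c else 0) +
      ∑ j ∈ Finset.range (n + 1), if 2 * j < n then g (n - j) * a j / c else 0 := by
  have e : ∑ j ∈ Finset.range (n + 1), (if 2 * j < n then g (n - j) * a j / c else 0)
      = ∑ i ∈ Finset.range (n + 1), if 2 * i ≤ n then 0 else g i * a (n - i) / c := by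
    rw [← Finset.sum_flip]
    refine Finset.sum_congr rfl fun i hi => ?_
    simp only [Finset.mem_range] at hi
    have : n - (n - i) = i := by omega
    rw [this]
    split_ifs <;> first | rfl | omega
  rw [e, ← Finset.sum_add_distrib, Finset.sum_div]
  rw [Finset.sum_range_succ]
  simp only [Nat.sub_self, ha0, mul_zero, zero_div, ite_self, add_zero]
  refine Finset.sum_congr rfl fun i hi => ?_
  split_ifs <;> simp

lemma km_contract (d : ℕ → ℝ) (K ρ : ℝ) (hρ : ρ < 1) (hd : ∀ n, 0 ≤ d n) (hK : ∀ n, d n ≤ K)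
    (h : ∀ b : ℕ → ℝ, ∀ L, (∀ n, d n ≤ b n) → (∀ n, b n ≤ K) → Tendsto b atTop (𝓝 L) →
      ∀ ε > 0, ∀ᶠ n in atTop, d n ≤ ρ * L + ε) :
    Tendsto d atTop (𝓝 0) := by
  set b : ℕ → ℝ := fun n => ⨆ m, d (n + m) with hb
  have bdd : ∀ n, BddAbove (Set.range fun m => d (n + m)) := fun n => ⟨K, by
    rintro _ ⟨m, rfl⟩; exact hK _⟩
  have hdb : ∀ n, d n ≤ b n := fun n => le_ciSup (bdd n) 0
  have hanti : Antitone b := antitone_nat_of_succ_le fun n => ciSup_le fun m => by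
    have := le_ciSup (bdd n) (1 + m)
    simpa [add_assoc] using this
  have hb0 : ∀ n, 0 ≤ b n := fun n => (hd n).trans (hdb n)
  have ht : Tendsto b atTop (𝓝 (⨅ n, b n)) :=
    tendsto_atTop_ciInf hanti ⟨0, by rintro _ ⟨m, rfl⟩; exact hb0 _⟩
  set L := ⨅ n, b n
  have hL0 : 0 ≤ L := ge_of_tendsto' ht hb0
  have key : L ≤ ρ * L := by
    refine le_of_forall_pos_le_add fun ε hε => ?_
    obtain ⟨N, hN⟩ := eventually_atTop.1 (h b L hdb (fun n => ciSup_le fun m => hK _) ht ε hε)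
    have : b N ≤ ρ * L + ε := ciSup_le fun m => hN _ (by omega)
    exact (hanti.le_of_tendsto ht N).trans this
  have : L = 0 := by nlinarith
  rw [this] at ht
  exact squeeze_zero hd hdb ht

lemma km_renewal (a m μ : ℕ → ℝ) (D β γ : ℝ) (hβ : 0 < β) (hγ : 0 < γ)
    (ha : ∀ n, 0 ≤ a n) (ha0 : a 0 = 0) (hm0 : ∀ n, 0 ≤ m n)
    (hμ : ∀ n, 0 < μ n) (hsμ : Summable μ) (hsum : β * ∑' n, μ n = 1 - γ)
    (hD : ∀ n k, 2 * k ≤ n → μ (n - k) ≤ D * μ n)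
    (hr : ∀ k, Tendsto (fun n => μ (n - k) / μ n) atTop (𝓝 1))
    (hm : Tendsto (fun n => m n / μ n) atTop (𝓝 0))
    (hrec : ∀ n, 1 ≤ n → a n = m n + β * ∑ i ∈ Finset.range n, μ i * a (n - i)) :
    Summable a ∧ Tendsto (fun n => a n / μ n) atTop (𝓝 (β * (∑' n, a n) / γ)) := by
  -- summability of m
  have hms : Summable m := by
    refine summable_of_isBigO_nat hsμ ?_
    refine (Asymptotics.isLittleO_of_tendsto' ?_ hm).isBigO
    exact Eventually.of_forall fun n h => absurd h (hμ n).ne'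
  have hsa : Summable a := by
    refine summable_of_sum_range_le (c := (∑' n, m n) / γ) ha fun N => ?_
    rw [le_div_iff₀ hγ]
    set S := ∑ i ∈ Finset.range N, a i with hS
    have h1 : S ≤ ∑' n, m n + β * ((∑' n, μ n) * S) := by
      calc S ≤ ∑ n ∈ Finset.range N, (m n + β * ∑ i ∈ Finset.range n, μ i * a (n - i)) := by
            refine Finset.sum_le_sum fun n _ => ?_
            rcases Nat.eq_zero_or_pos n with rfl | h
            · simp [ha0, hm0]
            · exact (hrec n h).le
        _ = ∑ n ∈ Finset.range N, m n + β * ∑ n ∈ Finset.range N, ∑ i ∈ Finset.range n, μ i * a (n - i) := by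
            rw [Finset.sum_add_distrib, Finset.mul_sum]
        _ ≤ _ := by
            gcongr
            · exact hms.sum_le_tsum _ fun i _ => hm0 i
            · calc ∑ n ∈ Finset.range N, ∑ i ∈ Finset.range n, μ i * a (n - i)
                  ≤ ∑ i ∈ Finset.range N, μ i * S := by
                    rw [Finset.sum_comm' (t' := Finset.range N)
                      (s' := fun i => Finset.Ioo i N) (by intro x y; simp; omega)]
                    refine Finset.sum_le_sum fun i _ => ?_
                    rw [← Finset.mul_sum]
                    refine mul_le_mul_of_nonneg_left ?_ (hμ i).le
                    calc ∑ n ∈ Finset.Ioo i N, a (n - i) = ∑ n ∈ (Finset.Ioo i N).image (fun n => n - i), a n := by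
                          rw [Finset.sum_image]
                          intro x hx y hy hxy
                          simp at hx hy hxy; omega
                      _ ≤ S := by
                          refine Finset.sum_le_sum_of_subset_of_nonneg ?_ fun _ _ _ => ha _
                          intro x hx
                          simp at hx ⊢
                          omega
                _ = (∑ i ∈ Finset.range N, μ i) * S := by rw [Finset.sum_mul]
                _ ≤ _ := by
                    gcongr
                    · exact Finset.sum_nonneg fun _ _ => ha _
                    · exact hsμ.sum_le_tsum _ fun i _ => (hμ i).le
    have : β * ((∑' n, μ n) * S) = (1 - γ) * S := by rw [← hsum]; ring
    nlinarith
  refine ⟨hsa, ?_⟩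
  set A := ∑' n, a n with hA
  -- large index part
  have hH1 := km_H1 a μ D (fun _ i => μ i) 1 ha hsa hμ hD (fun _ i => (hμ i).le)
    (fun _ i => le_rfl) hr
  rw [one_mul] at hH1
  set s : ℕ → ℝ := fun n => m n / μ n + β * ∑ j ∈ Finset.range (n + 1),
    if 2 * j < n then μ (n - j) * a j / μ n else 0 with hs
  have hst : Tendsto s atTop (𝓝 (β * A)) := by
    simpa using hm.add (hH1.const_mul β)
  have hH2 := fun (b : ℕ → ℝ) (B L : ℝ) (hb : ∀ n, 0 ≤ b n) (hB : ∀ n, b n ≤ B)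
      (hL : Tendsto b atTop (𝓝 L)) =>
    km_H2 b μ B D (fun _ i => μ i) (fun i => μ i * L) hb hB hμ hsμ hD hr (fun _ i => (hμ i).le)
      (fun _ i => le_rfl) (fun i => (hL.comp (tendsto_sub_atTop_nat i)).const_mul _)
  set b : ℕ → ℝ := fun n => a n / μ n with hbdef
  have hba : ∀ n, a n = b n * μ n := fun n => by
    simp only [hbdef]; rw [div_mul_cancel₀ _ (hμ n).ne']
  have hb0 : ∀ n, 0 ≤ b n := fun n => div_nonneg (ha n) (hμ n).le
  have hbrec : ∀ n, 1 ≤ n → b n = s n + β * ∑ i ∈ Finset.range (n + 1),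
      if 2 * i ≤ n then μ i * (b (n - i) * μ (n - i)) / μ n else 0 := by
    intro n hn
    have h1 := km_split n μ a (μ n) ha0
    simp only [hbdef]
    rw [hrec n hn, add_div, mul_div_assoc, h1]
    simp only [hs]
    have : ∀ k, a k / μ k * μ k = a k := fun k => (hba k).symm
    simp only [this]
    ring
  -- boundedness
  have hone := hH2 (fun _ => 1) 1 1 (fun _ => zero_le_one) (fun _ => le_rfl) tendsto_const_nhds
  simp only [mul_one, one_mul] at hone
  have hone' := hone.const_mul β
  rw [hsum] at hone'
  obtain ⟨N, hN⟩ := eventually_atTop.1 (hone'.eventually (gt_mem_nhds (show 1 - γ < 1 - γ / 2 by linarith)))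
  obtain ⟨c, hc⟩ := hst.bddAbove_range
  have hcs : ∀ n, s n ≤ c := fun n => hc ⟨n, rfl⟩
  obtain ⟨M, hM⟩ : ∃ M, ∀ n < N + 1, b n ≤ M := by
    refine ⟨∑ i ∈ Finset.range (N + 1), b i, fun n hn => ?_⟩
    exact Finset.single_le_sum (fun i _ => hb0 i) (Finset.mem_range.2 hn)
  have hbd : ∃ B, ∀ n, b n ≤ B := by
    refine ⟨max M (2 * c / γ), fun n => ?_⟩
    set B := max M (2 * c / γ) with hB
    induction n using Nat.strong_induction_on with
    | _ n ih =>
      by_cases hn : n < N + 1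
      · exact (hM n hn).trans (le_max_left _ _)
      by_contra hcon
      push Not at hcon
      have h1 := hbrec n (by omega)
      have h2 : ∑ i ∈ Finset.range (n + 1),
          (if 2 * i ≤ n then μ i * (b (n - i) * μ (n - i)) / μ n else 0) ≤
          b n * ∑ i ∈ Finset.range (n + 1), if 2 * i ≤ n then μ i * μ (n - i) / μ n else 0 := by
        rw [Finset.mul_sum]
        refine Finset.sum_le_sum fun i _ => ?_
        split_ifs
        · have : b (n - i) ≤ b n := by
            rcases Nat.eq_zero_or_pos i with rfl | hi
            · simp
            · exact (ih (n - i) (by omega)).trans hcon.le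
          rw [show b n * (μ i * μ (n - i) / μ n) = μ i * (b n * μ (n - i)) / μ n by ring]
          have e1 := hμ i
          have e2 := hμ n
          have e3 := hμ (n - i)
          gcongr
        · simp
      have h3 := hN n (by omega)
      have h4 := hcs n
      have h5 : b n ≤ c + b n * (1 - γ / 2) := by
        calc b n ≤ c + β * (b n * ∑ i ∈ Finset.range (n + 1), if 2 * i ≤ n then μ i * μ (n - i) / μ n else 0) := by
              conv_lhs => rw [h1]
              gcongr
          _ = c + b n * (β * ∑ i ∈ Finset.range (n + 1), if 2 * i ≤ n then μ i * μ (n - i) / μ n else 0) := by ring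
          _ ≤ _ := by
              have := hb0 n
              gcongr
      have h6 : b n ≤ 2 * c / γ := by
        rw [le_div_iff₀ hγ]; linarith
      exact absurd (h6.trans (le_max_right M _)) (not_le.2 hcon)
  obtain ⟨B, hB⟩ := hbd
  set C := β * A / γ with hC
  have hC0 : 0 ≤ C := by
    have : 0 ≤ A := tsum_nonneg ha
    positivity
  have hB0 : 0 ≤ B := (hb0 0).trans (hB 0)
  -- contraction
  have hd : Tendsto (fun n => |b n - C|) atTop (𝓝 0) := by
    refine km_contract _ (B + C) (1 - γ) (by linarith) (fun n => abs_nonneg _) (fun n => ?_) ?_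
    · rw [abs_le]; constructor <;> linarith [hb0 n, hB n]
    intro b' L h1 h2 h3 ε hε
    have h4 := (hH2 b' (B + C) L (fun n => (abs_nonneg _).trans (h1 n)) h2 h3).const_mul β
    rw [tsum_mul_right, ← mul_assoc, hsum] at h4
    set v : ℕ → ℝ := fun n => ∑ i ∈ Finset.range (n + 1), if 2 * i ≤ n then μ i * μ (n - i) / μ n else 0 with hv
    have h5 : Tendsto (fun n => |s n + C * (β * v n) - C|) atTop (𝓝 0) := by
      have := ((hst.add (hone'.const_mul C)).sub_const C).abs
      have e : β * A + C * (1 - γ) - C = 0 := by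
        rw [hC]; field_simp; ring
      rw [e, abs_zero] at this
      exact this
    have h6 := h4.add h5
    rw [add_zero] at h6
    filter_upwards [h6.eventually (gt_mem_nhds (show (1 - γ) * L < (1 - γ) * L + ε by linarith)),
      eventually_ge_atTop 1] with n hn hn1
    refine le_trans ?_ hn.le
    have e1 : b n - C = β * (∑ i ∈ Finset.range (n + 1),
        if 2 * i ≤ n then μ i * ((b (n - i) - C) * μ (n - i)) / μ n else 0)
        + (s n + C * (β * v n) - C) := by
      conv_lhs => rw [hbrec n hn1]
      have : (∑ i ∈ Finset.range (n + 1),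
        if 2 * i ≤ n then μ i * ((b (n - i) - C) * μ (n - i)) / μ n else 0) =
        (∑ i ∈ Finset.range (n + 1),
        if 2 * i ≤ n then μ i * (b (n - i) * μ (n - i)) / μ n else 0) - C * v n := by
        rw [hv, Finset.mul_sum, ← Finset.sum_sub_distrib]
        refine Finset.sum_congr rfl fun i _ => ?_
        split_ifs <;> ring
      rw [this]; ring
    rw [e1]
    refine (abs_add_le _ _).trans ?_
    gcongr
    rw [abs_mul, abs_of_pos hβ]
    gcongr
    refine (Finset.abs_sum_le_sum_abs _ _).trans (Finset.sum_le_sum fun i _ => ?_)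
    split_ifs
    · rw [abs_div, abs_mul, abs_mul, abs_of_pos (hμ i), abs_of_pos (hμ n), abs_of_pos (hμ (n - i))]
      have e1 := hμ i
      have e2 := hμ n
      have e3 := hμ (n - i)
      gcongr
      exact h1 _
    · simp
  exact tendsto_iff_norm_sub_tendsto_zero.2 (by simpa using hd)

lemma km_layer (q : Measure ℝ) [IsProbabilityMeasure q] (c : ℝ) (hc0 : 0 ≤ c)
    (n : ℕ) (hn : 1 ≤ n) :
    ∫ y in Set.Ioo c 1, y ^ n ∂q =
      ∫ t in (0:ℝ)..1, q.real (Set.Ioo (max t c) 1) * (n * t ^ (n - 1)) := by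
  have hnn : 0 ≤ᵐ[q.restrict (Set.Ioo c 1)] fun y : ℝ => y := by
    filter_upwards [ae_restrict_mem measurableSet_Ioo] with y hy
    exact hc0.trans hy.1.le
  have h := lintegral_comp_eq_lintegral_meas_lt_mul (q.restrict (Set.Ioo c 1))
    (f := fun y : ℝ => y) (g := fun t : ℝ => n * t ^ (n - 1)) hnn (by fun_prop)
    (fun t _ => (by fun_prop : Continuous fun t : ℝ => (n:ℝ) * t ^ (n - 1)).intervalIntegrable _ _)
    (by
      filter_upwards [ae_restrict_mem measurableSet_Ioi] with t ht
      have : 0 < t := ht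
      positivity)
  have e1 : ∀ y : ℝ, ∫ t in (0:ℝ)..y, (n:ℝ) * t ^ (n - 1) = y ^ n := by
    intro y
    have hn' : (n : ℝ) ≠ 0 := by positivity
    obtain ⟨k, rfl⟩ : ∃ k, n = k + 1 := ⟨n - 1, by omega⟩
    rw [intervalIntegral.integral_const_mul, integral_pow]
    simp only [Nat.add_sub_cancel]
    push_cast at hn' ⊢
    field_simp
    simp
  have e2 : ∀ t : ℝ, (q.restrict (Set.Ioo c 1)) {a : ℝ | t < a} = q (Set.Ioo (max t c) 1) := by
    intro t
    rw [Measure.restrict_apply (show MeasurableSet {a : ℝ | t < a} from measurableSet_Ioi)]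
    congr 1
    ext a; simp; tauto
  simp only [e1, e2] at h
  rw [integral_eq_lintegral_of_nonneg_ae, h, intervalIntegral.integral_of_le zero_le_one,
    integral_eq_lintegral_of_nonneg_ae]
  · congr 1
    have : ∀ t : ℝ, q (Set.Ioo (max t c) 1) * ENNReal.ofReal (n * t ^ (n - 1)) =
        ENNReal.ofReal (q.real (Set.Ioo (max t c) 1) * (n * t ^ (n - 1))) := by
      intro t
      rw [ENNReal.ofReal_mul measureReal_nonneg, ofReal_measureReal]
    simp only [this]
    rw [← Set.Ioc_union_Ioi_eq_Ioi (zero_le_one (α := ℝ)),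
      lintegral_union measurableSet_Ioi (Set.Ioc_disjoint_Ioi le_rfl)]
    rw [setLIntegral_congr_fun (s := Set.Ioi (1:ℝ)) (g := fun _ => 0) measurableSet_Ioi]
    · simp
    · intro t ht
      have : (1:ℝ) < t := ht
      have : Set.Ioo (max t c) 1 = ∅ := Set.Ioo_eq_empty (not_lt.2 (le_trans (by linarith) (le_max_left t c)))
      simp only [this]
      simp
  · filter_upwards [ae_restrict_mem measurableSet_Ioc] with t ht
    have : 0 < t := ht.1
    simp only [Pi.zero_apply]
    positivity
  · apply Measurable.aestronglyMeasurable
    apply Measurable.mul _ (by fun_prop)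
    apply Antitone.measurable
    intro s t hst
    exact measureReal_mono (Set.Ioo_subset_Ioo_left (max_le_max_right _ hst))
  · filter_upwards [hnn] with y hy
    exact pow_nonneg hy _
  · fun_prop

lemma km_layer' (q : Measure ℝ) [IsProbabilityMeasure q] 
    (n : ℕ) (hn : 1 ≤ n) (ξ : ℝ) (hξ : ξ ≤ n) :
    ∫ y in Set.Ioo (1 - ξ / n) 1, y ^ n ∂q =
      ∫ s in Set.Ioi (0:ℝ), (Set.Ioc (0:ℝ) n).indicator
        (fun s => q.real (Set.Ioo (1 - min s ξ / n) 1) * (1 - s / n) ^ (n - 1)) s := by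
  have hn' : (0 : ℝ) < n := by positivity
  rw [km_layer q _ (by rw [sub_nonneg, div_le_one hn']; exact hξ) n hn]
  rw [setIntegral_indicator measurableSet_Ioc,
    Set.inter_eq_right.2 (fun s hs => hs.1), ← intervalIntegral.integral_of_le hn'.le]
  have := intervalIntegral.integral_comp_sub_div (a := 0) (b := n) 
    (fun t => q.real (Set.Ioo (max t (1 - ξ / n)) 1) * (n * t ^ (n - 1))) hn'.ne' 1
  rw [zero_div, sub_zero, div_self hn'.ne', sub_self] at this
  have e : ∀ s : ℝ, q.real (Set.Ioo (max (1 - s / n) (1 - ξ / n)) 1) * (n * (1 - s / n) ^ (n - 1))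
      = n * (q.real (Set.Ioo (1 - min s ξ / n) 1) * (1 - s / n) ^ (n - 1)) := by
    intro s
    have : max (1 - s / n) (1 - ξ / n) = 1 - min s ξ / n := by
      rcases le_total s ξ with h | h
      · rw [min_eq_left h, max_eq_left]
        gcongr
      · rw [min_eq_right h, max_eq_right]
        gcongr
    rw [this]; ring
  simp only [e] at this
  rw [intervalIntegral.integral_const_mul, smul_eq_mul] at this
  exact (mul_left_cancel₀ hn'.ne' this).symm

lemma km_tailbound (q : Measure ℝ) [IsProbabilityMeasure q] (α : ℝ) (hα : 1 < α)
    (htail : Tendsto (fun h : ℝ => (q (Set.Ioo (1 - h) 1)).toReal / h ^ α)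
      (𝓝[>] (0:ℝ)) (𝓝 1)) :
    ∃ K, 0 < K ∧ ∀ h, 0 < h → q.real (Set.Ioo (1 - h) 1) ≤ K * h ^ α := by
  have h1 := htail.eventually (gt_mem_nhds (show (1:ℝ) < 2 by norm_num))
  rw [eventually_nhdsWithin_iff, Metric.eventually_nhds_iff] at h1
  obtain ⟨δ, hδ, h1⟩ := h1
  refine ⟨max 2 (1 / δ ^ α), by positivity, fun h hh => ?_⟩
  have hp : 0 < h ^ α := Real.rpow_pos_of_pos hh _
  by_cases hd : h < δ
  · have := h1 (y := h) (by simpa [abs_of_pos hh] using hd) hh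
    rw [div_lt_iff₀ hp] at this
    refine this.le.trans ?_
    gcongr
    exact le_max_left _ _
  · push Not at hd
    calc q.real (Set.Ioo (1 - h) 1) ≤ 1 := measureReal_le_one
      _ ≤ (1 / δ ^ α) * h ^ α := by
        rw [one_div, inv_mul_eq_div, le_div_iff₀ (by positivity), one_mul]
        gcongr
      _ ≤ _ := by
        gcongr
        exact le_max_right _ _

lemma km_asym (q : Measure ℝ) [IsProbabilityMeasure q] (α : ℝ) (hα : 1 < α)
    (htail : Tendsto (fun h : ℝ => (q (Set.Ioo (1 - h) 1)).toReal / h ^ α)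
      (𝓝[>] (0:ℝ)) (𝓝 1)) (ξ : ℕ → ℝ) (l : ℝ → ℝ)
    (hξ : ∀ᶠ n in atTop, 0 < ξ n ∧ ξ n ≤ n)
    (hl : ∀ s, 0 < s → Tendsto (fun n => min s (ξ n)) atTop (𝓝 (l s))) :
    Tendsto (fun n : ℕ => (n:ℝ) ^ α * ∫ y in Set.Ioo (1 - ξ n / n) 1, y ^ n ∂q) atTop
      (𝓝 (∫ s in Set.Ioi (0:ℝ), l s ^ α * Real.exp (-s))) := by
  obtain ⟨K, hK, hKb⟩ := km_tailbound q α hα htail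
  have key : Tendsto (fun n : ℕ => ∫ s in Set.Ioi (0:ℝ), (n:ℝ) ^ α * (Set.Ioc (0:ℝ) n).indicator
        (fun s => q.real (Set.Ioo (1 - min s (ξ n) / n) 1) * (1 - s / n) ^ (n - 1)) s) atTop
      (𝓝 (∫ s in Set.Ioi (0:ℝ), l s ^ α * Real.exp (-s))) := by
    refine tendsto_integral_filter_of_dominated_convergence
      (fun s => K * (s ^ α * Real.exp (-(1/2) * s))) ?_ ?_ ?_ ?_
    · filter_upwards [eventually_ge_atTop 1] with n hn
      apply Measurable.aestronglyMeasurable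
      apply Measurable.const_mul
      apply Measurable.indicator _ measurableSet_Ioc
      apply Measurable.mul _ (by fun_prop)
      apply Monotone.measurable
      intro s t hst
      refine measureReal_mono (Set.Ioo_subset_Ioo_left ?_)
      gcongr
    · filter_upwards [eventually_ge_atTop 2, hξ] with n hn hx
      have hn' : (2 : ℝ) ≤ n := by exact_mod_cast hn
      filter_upwards [ae_restrict_mem measurableSet_Ioi] with s hs
      have hs : 0 < s := hs
      rw [norm_mul, Real.norm_of_nonneg (by positivity)]
      by_cases hsn : s ∈ Set.Ioc (0:ℝ) n
      · rw [Set.indicator_of_mem hsn]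
        have h0 : 0 ≤ 1 - s / n := by
          rw [sub_nonneg, div_le_one (by linarith)]; exact hsn.2
        rw [Real.norm_of_nonneg (by positivity)]
        have h1 : q.real (Set.Ioo (1 - min s (ξ n) / n) 1) ≤ K * (s / n) ^ α := by
          refine (measureReal_mono (Set.Ioo_subset_Ioo_left ?_)).trans (hKb (s / n) (by positivity))
          gcongr
          exact min_le_left _ _
        have h2 : (1 - s / n) ^ (n - 1) ≤ Real.exp (-(1/2) * s) := by
          calc (1 - s / n) ^ (n - 1) ≤ (Real.exp (-(s / n))) ^ (n - 1) := by
                gcongr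
                exact Real.one_sub_le_exp_neg _
            _ = Real.exp ((n - 1 : ℕ) * (-(s/n))) := by rw [Real.exp_nat_mul]
            _ ≤ _ := by
                apply Real.exp_le_exp.2
                rw [Nat.cast_sub (by omega)]
                have : ((n:ℝ) - 1) * (s / n) ≥ 1/2 * s := by
                  rw [mul_div_assoc', ge_iff_le, le_div_iff₀ (by linarith)]
                  nlinarith
                push_cast
                linarith
        calc (n:ℝ) ^ α * (q.real (Set.Ioo (1 - min s (ξ n) / n) 1) * (1 - s / n) ^ (n - 1))
            ≤ (n:ℝ) ^ α * ((K * (s / n) ^ α) * Real.exp (-(1/2) * s)) := by gcongr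
          _ = _ := by
            rw [Real.div_rpow hs.le (by positivity)]
            have : (0:ℝ) < (n:ℝ) ^ α := by positivity
            field_simp
      · rw [Set.indicator_of_notMem hsn]
        simp only [norm_zero, mul_zero]
        positivity
    · have := integrableOn_rpow_mul_exp_neg_mul_rpow (s := α) (p := 1) (b := 1/2)
        (by linarith) one_pos (by norm_num)
      simp only [Real.rpow_one] at this
      exact this.const_mul K
    · filter_upwards [ae_restrict_mem measurableSet_Ioi] with s hs
      have hs : 0 < s := hs
      have hh : Tendsto (fun n : ℕ => min s (ξ n) / n) atTop (𝓝[>] 0) := by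
        refine tendsto_nhdsWithin_iff.2 ⟨(hl s hs).div_atTop tendsto_natCast_atTop_atTop, ?_⟩
        filter_upwards [hξ, eventually_ge_atTop 1] with n hn hn1
        have := lt_min hs hn.1
        exact div_pos this (by positivity)
      have h1 := htail.comp hh
      have h2 : Tendsto (fun n => (min s (ξ n)) ^ α) atTop (𝓝 (l s ^ α)) :=
        (hl s hs).rpow_const (Or.inr (by linarith))
      have h3 : Tendsto (fun n : ℕ => (1 - s / n) ^ (n - 1)) atTop (𝓝 (Real.exp (-s))) := by
        have a1 := Real.tendsto_one_add_div_pow_exp (-s)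
        have a2 : Tendsto (fun n : ℕ => 1 - s / (n:ℝ)) atTop (𝓝 1) := by
          simpa using (tendsto_const_div_atTop_nhds_zero_nat s).const_sub 1
        have a3 := a1.div a2 one_ne_zero
        rw [div_one] at a3
        refine a3.congr' ?_
        filter_upwards [a2.eventually_ne one_ne_zero, eventually_ge_atTop 1] with n hn hn1
        simp only [Pi.div_apply, neg_div, ← sub_eq_add_neg]
        rw [div_eq_iff hn, ← pow_succ]
        congr 1; omega
      have h4 := (h1.mul h2).mul h3
      rw [one_mul] at h4
      refine h4.congr' ?_
      filter_upwards [hξ, eventually_ge_atTop 1, eventually_ge_atTop ⌈s⌉₊] with n hn hn1 hns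
      have hsn : s ∈ Set.Ioc (0:ℝ) n := ⟨hs, (Nat.le_ceil s).trans (by exact_mod_cast hns)⟩
      rw [Set.indicator_of_mem hsn]
      have hmin := lt_min hs hn.1
      simp only [Function.comp, measureReal_def]
      rw [Real.div_rpow hmin.le (by positivity)]
      have : (0:ℝ) < (n:ℝ) ^ α := by positivity
      have : (0:ℝ) < (min s (ξ n)) ^ α := by positivity
      field_simp
  refine key.congr' ?_
  filter_upwards [hξ, eventually_ge_atTop 1] with n hn hn1
  rw [km_layer' q n hn1 (ξ n) hn.2, integral_const_mul]

lemma km_gamma (α : ℝ) (hα : 1 < α) :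
    ∫ s in Set.Ioi (0:ℝ), s ^ α * Real.exp (-s) = α * Real.Gamma α := by
  rw [← Real.Gamma_add_one (by linarith), Real.Gamma_eq_integral (by linarith)]
  refine setIntegral_congr_fun measurableSet_Ioi fun s _ => ?_
  simp only [add_sub_cancel_right]; ring

lemma km_incgamma (α : ℝ) (hα : 1 < α) (x : ℝ) (hx : 0 < x) :
    ∫ s in Set.Ioi (0:ℝ), (min s x) ^ α * Real.exp (-s) =
      α * ∫ y in (0:ℝ)..x, y ^ (α - 1) * Real.exp (-y) := by
  have c1 : Continuous fun s : ℝ => s ^ α := Real.continuous_rpow_const (by linarith)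
  have c2 : Continuous fun s : ℝ => s ^ (α - 1) := Real.continuous_rpow_const (by linarith)
  have hi2 : IntegrableOn (fun s : ℝ => (min s x) ^ α * Real.exp (-s)) (Set.Ioi x) := by
    have : IntegrableOn (fun s : ℝ => x ^ α * Real.exp (-s)) (Set.Ioi x) :=
      (integrableOn_exp_neg_Ioi x).const_mul _
    refine this.congr_fun (fun s hs => ?_) measurableSet_Ioi
    simp only [min_eq_right (le_of_lt (Set.mem_Ioi.1 hs))]
  have hi1 : IntegrableOn (fun s : ℝ => (min s x) ^ α * Real.exp (-s)) (Set.Ioc 0 x) := by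
    refine (Continuous.integrableOn_Ioc ?_)
    exact (c1.comp (by fun_prop : Continuous fun s : ℝ => min s x)).mul (by fun_prop)
  rw [← Set.Ioc_union_Ioi_eq_Ioi hx.le, setIntegral_union (Set.Ioc_disjoint_Ioi le_rfl)
    measurableSet_Ioi hi1 hi2]
  have e1 : ∫ s in Set.Ioc 0 x, (min s x) ^ α * Real.exp (-s) = ∫ s in (0:ℝ)..x, s ^ α * Real.exp (-s) := by
    rw [intervalIntegral.integral_of_le hx.le]
    refine setIntegral_congr_fun measurableSet_Ioc fun s hs => ?_
    simp only [min_eq_left hs.2]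
  have e2 : ∫ s in Set.Ioi x, (min s x) ^ α * Real.exp (-s) = x ^ α * Real.exp (-x) := by
    rw [← integral_exp_neg_Ioi x, ← integral_const_mul]
    refine setIntegral_congr_fun measurableSet_Ioi fun s hs => ?_
    simp only [min_eq_right (le_of_lt (Set.mem_Ioi.1 hs))]
  rw [e1, e2]
  have ftc := intervalIntegral.integral_eq_sub_of_hasDerivAt (a := 0) (b := x)
    (f := fun s : ℝ => s ^ α * Real.exp (-s))
    (f' := fun s : ℝ => α * (s ^ (α - 1) * Real.exp (-s)) - s ^ α * Real.exp (-s)) ?_ ?_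
  · rw [intervalIntegral.integral_sub, intervalIntegral.integral_const_mul,
      Real.zero_rpow (by linarith)] at ftc
    · linarith
    · exact ((c2.mul (by fun_prop)).const_mul α).intervalIntegrable _ _ 
    · exact (c1.mul (by fun_prop)).intervalIntegrable _ _
  · intro s _
    have d1 := Real.hasDerivAt_rpow_const (x := s) (p := α) (Or.inr hα.le)
    have d2 := (hasDerivAt_neg s).exp
    exact (d1.mul d2).congr_deriv (by ring)
  · exact (((c2.mul (by fun_prop)).const_mul α).sub (c1.mul (by fun_prop))).intervalIntegrable _ _

lemma km_int (ν : Measure ℝ) [IsFiniteMeasure ν] (hν : ν (Set.Icc (0:ℝ) 1)ᶜ = 0) (k : ℕ) :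
    Integrable (fun y : ℝ => y ^ k) ν := by
  refine Integrable.of_bound (C := 1) (by fun_prop) ?_
  have : ∀ᵐ y ∂ν, y ∈ Set.Icc (0:ℝ) 1 := hν
  filter_upwards [this] with y hy
  rw [Real.norm_of_nonneg (pow_nonneg hy.1 _)]
  exact pow_le_one₀ hy.1 hy.2

lemma km_step (P q : Measure ℝ) [IsProbabilityMeasure P] [IsProbabilityMeasure q]
    (hP : P (Set.Icc (0:ℝ) 1)ᶜ = 0) (hq : q (Set.Icc (0:ℝ) 1)ᶜ = 0) (r β : ℝ) (hr : 0 ≤ r)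
    (hβ : 0 ≤ β) (s : Set ℝ) (hs : MeasurableSet s) (k : ℕ) :
    ∫ y in s, y ^ k ∂(ENNReal.ofReal r • (P.withDensity fun x => ENNReal.ofReal x)
          + ENNReal.ofReal β • q) = r * ∫ y in s, y ^ (k + 1) ∂P + β * ∫ y in s, y ^ k ∂q := by
  have hi1 : Integrable (fun y : ℝ => y) P := by simpa using km_int P hP 1
  have : IsFiniteMeasure (P.withDensity fun x => ENNReal.ofReal x) :=
    isFiniteMeasure_withDensity_ofReal hi1.2
  have hP' : (P.withDensity fun x => ENNReal.ofReal x) (Set.Icc (0:ℝ) 1)ᶜ = 0 :=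
    withDensity_absolutelyContinuous _ _ hP
  rw [Measure.restrict_add, Measure.restrict_smul, Measure.restrict_smul, integral_add_measure,
    integral_smul_measure, integral_smul_measure, ENNReal.toReal_ofReal hr,
    ENNReal.toReal_ofReal hβ, smul_eq_mul, smul_eq_mul, restrict_withDensity hs,
    integral_withDensity_eq_integral_toReal_smul]
  · congr 2
    refine integral_congr_ae ?_
    have : ∀ᵐ y ∂P, y ∈ Set.Icc (0:ℝ) 1 := hP
    filter_upwards [ae_restrict_of_ae this] with y hy
    rw [ENNReal.toReal_ofReal hy.1, smul_eq_mul]; ring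
  · fun_prop
  · exact Eventually.of_forall fun _ => ENNReal.ofReal_lt_top
  · exact ((km_int _ hP' k).restrict).smul_measure ENNReal.ofReal_ne_top
  · exact ((km_int _ hq k).restrict).smul_measure ENNReal.ofReal_ne_top

lemma km_pos (q : Measure ℝ) [IsProbabilityMeasure q] (hq : q (Set.Icc (0:ℝ) 1)ᶜ = 0)
    (α : ℝ) (htail : Tendsto (fun h : ℝ => (q (Set.Ioo (1 - h) 1)).toReal / h ^ α)
      (𝓝[>] (0:ℝ)) (𝓝 1)) (n : ℕ) : 0 < ∫ y, y ^ n ∂q := by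
  have hae : ∀ᵐ y ∂q, y ∈ Set.Icc (0:ℝ) 1 := hq
  have hnn : 0 ≤ᵐ[q] fun y : ℝ => y ^ n := by
    filter_upwards [hae] with y hy
    exact pow_nonneg hy.1 _
  refine lt_of_le_of_ne (integral_nonneg_of_ae hnn) fun h0 => ?_
  have h1 := (integral_eq_zero_iff_of_nonneg_ae hnn (km_int q hq n)).1 h0.symm
  have h2 : q (Set.Ioo 0 1) = 0 := by
    refine measure_mono_null ?_ h1
    intro y hy h
    exact (pow_pos hy.1 n).ne' h
  have h3 : Tendsto (fun h : ℝ => (q (Set.Ioo (1 - h) 1)).toReal / h ^ α)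
      (𝓝[>] (0:ℝ)) (𝓝 0) := by
    refine tendsto_const_nhds.congr' ?_
    have : Set.Ioo (0:ℝ) 1 ∈ 𝓝[>] (0:ℝ) := Ioo_mem_nhdsGT one_pos
    filter_upwards [this] with h hh
    have : q (Set.Ioo (1 - h) 1) = 0 :=
      measure_mono_null (Set.Ioo_subset_Ioo_left (by linarith [hh.2])) h2
    simp [this]
  exact zero_ne_one (tendsto_nhds_unique h3 htail)

lemma km_model
    (q p0 : Measure ℝ) [IsProbabilityMeasure q] [IsProbabilityMeasure p0]
    (hqsupp : q (Set.Icc (0:ℝ) 1)ᶜ = 0) (hp0supp : p0 (Set.Icc (0:ℝ) 1)ᶜ = 0)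
    (β : ℝ) (hβ0 : 0 < β) (hβ1 : β < 1)
    (hmean : 0 < ∫ x, x ∂p0) (hqpos : 0 < ∫ x, x ∂q)
    (p : ℕ → Measure ℝ) (hp0 : p 0 = p0)
    (w : ℕ → ℝ) (hw : ∀ n, w n = ∫ x, x ∂(p n))
    (hrec : ∀ n, p (n + 1)
        = ENNReal.ofReal ((1 - β) / w n) • ((p n).withDensity fun x => ENNReal.ofReal x)
          + ENNReal.ofReal β • q) (n : ℕ) :
    IsProbabilityMeasure (p n) ∧ p n (Set.Icc (0:ℝ) 1)ᶜ = 0 ∧ 0 < w n := by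
  induction n with
  | zero => 
    rw [hw 0, hp0]
    exact ⟨inferInstance, hp0supp, hmean⟩
  | succ n ih =>
    obtain ⟨h1, h2, h3⟩ := ih
    have hr : 0 ≤ (1 - β) / w n := div_nonneg (by linarith) h3.le
    have hae : ∀ᵐ y ∂(p n), y ∈ Set.Icc (0:ℝ) 1 := h2
    have hnn : 0 ≤ᵐ[p n] fun y : ℝ => y := by
      filter_upwards [hae] with y hy
      exact hy.1
    refine ⟨⟨?_⟩, ?_, ?_⟩
    · rw [hrec n]
      simp only [Measure.coe_add, Measure.coe_smul, Pi.add_apply, Pi.smul_apply, smul_eq_mul,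
        measure_univ, mul_one, withDensity_apply _ MeasurableSet.univ, Measure.restrict_univ]
      rw [← ofReal_integral_eq_lintegral_ofReal (by simpa using km_int _ h2 1) hnn, ← hw n,
        ← ENNReal.ofReal_mul hr, div_mul_cancel₀ _ h3.ne',
        ← ENNReal.ofReal_add (by linarith) hβ0.le]
      simp
    · rw [hrec n]
      have := withDensity_absolutelyContinuous (p n) (fun x => ENNReal.ofReal x) h2
      simp [this, hqsupp]
    · have := km_step (p n) q h2 hqsupp _ β hr hβ0.le Set.univ MeasurableSet.univ 1
      simp only [Measure.restrict_univ, pow_one] at this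
      rw [hw, hrec n, this]
      have h4 : 0 ≤ ∫ y, y ^ (1 + 1) ∂(p n) := integral_nonneg fun y => by
        show (0:ℝ) ≤ y ^ (1 + 1)
        rw [one_add_one_eq_two]; positivity
      positivity

lemma km_formula
    (q p0 : Measure ℝ) [IsProbabilityMeasure q] [IsProbabilityMeasure p0]
    (hqsupp : q (Set.Icc (0:ℝ) 1)ᶜ = 0) (hp0supp : p0 (Set.Icc (0:ℝ) 1)ᶜ = 0)
    (β : ℝ) (hβ0 : 0 < β) (hβ1 : β < 1)
    (hmean : 0 < ∫ x, x ∂p0) (hqpos : 0 < ∫ x, x ∂q)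
    (p : ℕ → Measure ℝ) (hp0 : p 0 = p0)
    (w : ℕ → ℝ) (hw : ∀ n, w n = ∫ x, x ∂(p n))
    (hrec : ∀ n, p (n + 1)
        = ENNReal.ofReal ((1 - β) / w n) • ((p n).withDensity fun x => ENNReal.ofReal x)
          + ENNReal.ofReal β • q) :
    ∃ a : ℕ → ℝ, a 0 = 0 ∧ (∀ n, 1 ≤ n → 0 < a n) ∧ 
      ∀ n, 1 ≤ n → ∀ s : Set ℝ, MeasurableSet s → a n * (p n).real s = ∫ y in s, y ^ n ∂p0 +
        β * ∑ i ∈ Finset.range n, (∫ y in s, y ^ i ∂q) * a (n - i) := by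
  have hmod := km_model q p0 hqsupp hp0supp β hβ0 hβ1 hmean hqpos p hp0 w hw hrec
  set a : ℕ → ℝ := fun n => ∏ i ∈ Finset.range n, w i / (1 - β) with ha
  have hapos : ∀ n, 0 < a n := fun n => Finset.prod_pos fun i _ =>
    div_pos (hmod i).2.2 (by linarith)
  have hF : ∀ n k, ∀ s : Set ℝ, MeasurableSet s → a n * ∫ y in s, y ^ k ∂(p n) =
      ∫ y in s, y ^ (n + k) ∂p0 +
        β * ∑ i ∈ Finset.range n, (∫ y in s, y ^ (i + k) ∂q) * a (n - i) := by
    intro n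
    induction n with
    | zero => intro k s hs; simp [ha, hp0]
    | succ n ih =>
      intro k s hs
      obtain ⟨h1, h2, h3⟩ := hmod n
      have hr : 0 ≤ (1 - β) / w n := div_nonneg (by linarith) h3.le
      rw [hrec n, km_step (p n) q h2 hqsupp _ β hr hβ0.le s hs k, mul_add, ← mul_assoc]
      have e : a (n + 1) * ((1 - β) / w n) = a n := by
        simp only [ha]
        rw [Finset.prod_range_succ]
        have : 1 - β ≠ 0 := by linarith
        field_simp
      rw [e, ih (k + 1) s hs, Finset.sum_range_succ']
      simp only [Nat.add_sub_add_right, zero_add, Nat.sub_zero]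
      rw [show n + 1 + k = n + (k + 1) by ring]
      have : ∀ i, i + 1 + k = i + (k + 1) := fun i => by ring
      simp only [this]
      ring
  refine ⟨fun n => if n = 0 then 0 else a n, by simp, fun n hn => ?_, fun n hn s hs => ?_⟩
  · simp only [if_neg (show n ≠ 0 by omega)]; exact hapos n
  · have := hF n 0 s hs
    simp only [pow_zero, add_zero] at this
    simp only [if_neg (show n ≠ 0 by omega)]
    have e : ∫ y in s, (1:ℝ) ∂(p n) = (p n).real s := by simp
    rw [← e, this]
    congr 2
    refine Finset.sum_congr rfl fun i hi => ?_
    rw [Finset.mem_range] at hi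
    rw [if_neg (by omega)]

lemma km_geom (q : Measure ℝ) [IsProbabilityMeasure q] (hq : q (Set.Icc (0:ℝ) 1)ᶜ = 0)
    (hfin : ∫⁻ x, (ENNReal.ofReal (1 - x))⁻¹ ∂q ≠ ⊤) :
    (Summable fun n : ℕ => ∫ y, y ^ n ∂q) ∧
    ∑' n : ℕ, ∫ y, y ^ n ∂q = (∫⁻ x, (ENNReal.ofReal (1 - x))⁻¹ ∂q).toReal := by
  have hae : ∀ᵐ y ∂q, y ∈ Set.Icc (0:ℝ) 1 := hq
  have hnn : ∀ n : ℕ, 0 ≤ᵐ[q] fun y : ℝ => y ^ n := by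
    intro n
    filter_upwards [hae] with y hy
    exact pow_nonneg hy.1 _
  have e : ∫⁻ x, (ENNReal.ofReal (1 - x))⁻¹ ∂q = ∑' n : ℕ, ENNReal.ofReal (∫ y, y ^ n ∂q) := by
    simp_rw [fun n => ofReal_integral_eq_lintegral_ofReal (km_int q hq n) (hnn n)]
    rw [← lintegral_tsum (fun n => by fun_prop)]
    refine lintegral_congr_ae ?_
    filter_upwards [hae] with y hy
    simp_rw [ENNReal.ofReal_pow hy.1]
    rw [ENNReal.tsum_geometric, ENNReal.ofReal_sub _ hy.1, ENNReal.ofReal_one]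
  rw [e] at hfin ⊢
  have h0 : ∀ n : ℕ, 0 ≤ ∫ y, y ^ n ∂q := fun n => integral_nonneg_of_ae (hnn n)
  have := ENNReal.summable_toReal hfin
  simp only [ENNReal.toReal_ofReal (h0 _)] at this
  refine ⟨this, ?_⟩
  rw [ENNReal.tsum_toReal_eq (fun n => ENNReal.ofReal_ne_top)]
  simp only [ENNReal.toReal_ofReal (h0 _)]

lemma km_regular (μ : ℕ → ℝ) (α c : ℝ) (hα : 0 < α) (hc : 0 < c) (hμ : ∀ n, 0 < μ n)
    (hu : Tendsto (fun n : ℕ => (n:ℝ) ^ α * μ n) atTop (𝓝 c)) :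
    (∃ D, ∀ n k, 2 * k ≤ n → μ (n - k) ≤ D * μ n) ∧
    ∀ k, Tendsto (fun n => μ (n - k) / μ n) atTop (𝓝 1) := by
  constructor
  · obtain ⟨c2, hc2⟩ := hu.bddAbove_range
    obtain ⟨c3, hc3⟩ := (hu.inv₀ hc.ne').bddAbove_range
    have h2 : ∀ n : ℕ, (n:ℝ) ^ α * μ n ≤ c2 := fun n => hc2 ⟨n, rfl⟩
    have h3 : ∀ n : ℕ, ((n:ℝ) ^ α * μ n)⁻¹ ≤ c3 := fun n => hc3 ⟨n, rfl⟩
    refine ⟨max 1 (c2 * 2 ^ α * c3), fun n k hk => ?_⟩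
    rcases Nat.eq_zero_or_pos n with rfl | hn
    · simp only [zero_tsub]
      nlinarith [hμ 0, le_max_left 1 (c2 * 2 ^ α * c3)]
    have hn' : (0:ℝ) < n := by exact_mod_cast hn
    have hN : (0:ℝ) < (n:ℝ) ^ α := by positivity
    have hc20 : 0 ≤ c2 := le_trans (by have := hμ n; positivity) (h2 n)
    have hle : (n:ℝ) ≤ 2 * ((n - k : ℕ) : ℝ) := by
      have : n ≤ 2 * (n - k) := by omega
      exact_mod_cast this
    have h4 : (n:ℝ) ^ α ≤ 2 ^ α * ((n - k : ℕ) : ℝ) ^ α := by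
      rw [← Real.mul_rpow (by norm_num) (by positivity)]
      gcongr
    have h5 : μ (n - k) * (n:ℝ) ^ α ≤ c2 * 2 ^ α := by
      have := h2 (n - k)
      have hp := hμ (n - k)
      have : (0:ℝ) < 2 ^ α := by positivity
      calc μ (n - k) * (n:ℝ) ^ α ≤ μ (n - k) * (2 ^ α * ((n - k : ℕ) : ℝ) ^ α) := by gcongr
        _ = (((n - k : ℕ) : ℝ) ^ α * μ (n - k)) * 2 ^ α := by ring
        _ ≤ _ := by gcongr
    have h6 : 1 ≤ c3 * ((n:ℝ) ^ α * μ n) := by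
      have := h3 n
      rwa [inv_le_iff_one_le_mul₀ (mul_pos hN (hμ n))] at this
    have h7 : μ (n - k) ≤ c2 * 2 ^ α * c3 * μ n := by
      refine le_of_mul_le_mul_right (a := (n:ℝ) ^ α) ?_ hN
      have : 0 ≤ c2 * 2 ^ α := by positivity
      nlinarith [mul_le_mul_of_nonneg_left h6 this]
    refine h7.trans ?_
    have := (hμ n).le
    gcongr
    exact le_max_right _ _
  · intro k
    have h1 := (hu.comp (tendsto_sub_atTop_nat k)).div hu hc.ne'
    rw [div_self hc.ne'] at h1
    have h2 : Tendsto (fun n : ℕ => ((n - k : ℕ) : ℝ) / n) atTop (𝓝 1) := by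
      have : Tendsto (fun n : ℕ => 1 - (k:ℝ) / (n:ℝ)) atTop (𝓝 1) := by
        simpa using (tendsto_const_div_atTop_nhds_zero_nat (k:ℝ)).const_sub 1
      refine this.congr' ?_
      filter_upwards [eventually_gt_atTop k] with n hn
      rw [Nat.cast_sub hn.le]
      have : (n:ℝ) ≠ 0 := by
        have : n ≠ 0 := by omega
        exact_mod_cast this
      field_simp
    have h3 := h2.rpow_const (p := α) (Or.inr hα.le)
    rw [Real.one_rpow] at h3
    have h4 := h1.div h3 one_ne_zero
    rw [div_one] at h4
    refine h4.congr' ?_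
    filter_upwards [eventually_gt_atTop k] with n hn
    simp only [Pi.div_apply, Function.comp]
    rw [Real.div_rpow (by positivity) (by positivity)]
    have e1 : (0:ℝ) < (n:ℝ) ^ α := by
      have : (0:ℝ) < n := by
        have : 0 < n := by omega
        exact_mod_cast this
      positivity
    have e2 : (0:ℝ) < ((n - k : ℕ):ℝ) ^ α := by
      have : (0:ℝ) < ((n - k : ℕ):ℝ) := by
        have : 0 < n - k := by omega
        exact_mod_cast this
      positivity
    have := hμ n
    field_simp


/-- **Emergence of condensation in Kingman's model.**
Under the tail condition with exponent `α > 1`, moment dominance `m n / μ n → 0` and the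
condensation condition `γ(β) > 0`, the fitness distributions `p n` of Kingman's model satisfy,
for every `x > 0`,
`p n ((1 - x/n, 1)) → (γ(β)/Γ(α)) ∫_0^x y^(α-1) e^(-y) dy`. -/
theorem kingman_condensation_wave
    (q p0 : Measure ℝ) [IsProbabilityMeasure q] [IsProbabilityMeasure p0]
    (hqsupp : q (Set.Icc (0:ℝ) 1)ᶜ = 0) (hp0supp : p0 (Set.Icc (0:ℝ) 1)ᶜ = 0)
    (β : ℝ) (hβ0 : 0 < β) (hβ1 : β < 1)
    (hmean : 0 < ∫ x, x ∂p0)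
    (p : ℕ → Measure ℝ) (hp0 : p 0 = p0)
    (w : ℕ → ℝ) (hw : ∀ n, w n = ∫ x, x ∂(p n))
    (hrec : ∀ n, p (n + 1)
        = ENNReal.ofReal ((1 - β) / w n) • ((p n).withDensity fun x => ENNReal.ofReal x)
          + ENNReal.ofReal β • q)
    (m μ : ℕ → ℝ)
    (hm : ∀ n, m n = ∫ x, x ^ n ∂p0)
    (hμ : ∀ n, μ n = ∫ x, x ^ n ∂q)
    (α : ℝ) (hα : 1 < α)
    (htail : Tendsto (fun h : ℝ => (q (Set.Ioo (1 - h) 1)).toReal / h ^ α)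
      (𝓝[>] (0:ℝ)) (𝓝 1))
    (hmdom : Tendsto (fun n => m n / μ n) atTop (𝓝 0))
    (hfin : ∫⁻ x, (ENNReal.ofReal (1 - x))⁻¹ ∂q ≠ ⊤)
    (γ : ℝ) (hγdef : γ = 1 - β * (∫⁻ x, (ENNReal.ofReal (1 - x))⁻¹ ∂q).toReal)
    (hγpos : 0 < γ) :
    ∀ x : ℝ, 0 < x →
      Tendsto (fun n : ℕ => (p n (Set.Ioo (1 - x / (n:ℝ)) 1)).toReal) atTop
        (𝓝 (γ / Real.Gamma α * ∫ y in (0:ℝ)..x, y ^ (α - 1) * Real.exp (-y))) := by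
  intro x hx
  have hqae : ∀ᵐ y ∂q, y ∈ Set.Icc (0:ℝ) 1 := hqsupp
  have hpae : ∀ᵐ y ∂p0, y ∈ Set.Icc (0:ℝ) 1 := hp0supp
  have hqnn : ∀ n : ℕ, 0 ≤ᵐ[q] fun y : ℝ => y ^ n := fun n => by
    filter_upwards [hqae] with y hy
    exact pow_nonneg hy.1 _
  have hpnn : ∀ n : ℕ, 0 ≤ᵐ[p0] fun y : ℝ => y ^ n := fun n => by
    filter_upwards [hpae] with y hy
    exact pow_nonneg hy.1 _
  have hμpos : ∀ n, 0 < μ n := fun n => by rw [hμ]; exact km_pos q hqsupp α htail n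
  have hm0 : ∀ n, 0 ≤ m n := fun n => by rw [hm]; exact integral_nonneg_of_ae (hpnn n)
  have hqpos : 0 < ∫ y, y ∂q := by simpa using km_pos q hqsupp α htail 1
  obtain ⟨a, ha0, hapos, haF⟩ := km_formula q p0 hqsupp hp0supp β hβ0 hβ1 hmean hqpos p hp0 w hw hrec
  have hmod := km_model q p0 hqsupp hp0supp β hβ0 hβ1 hmean hqpos p hp0 w hw hrec
  have hann : ∀ n, 0 ≤ a n := fun n => by
    rcases Nat.eq_zero_or_pos n with rfl | h
    · rw [ha0]
    · exact (hapos n h).le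
  -- the series of moments
  have hμ' : μ = fun n : ℕ => ∫ y, y ^ n ∂q := funext hμ
  obtain ⟨hsμ, htsum⟩ := km_geom q hqsupp hfin
  rw [← hμ'] at hsμ
  have hsum : β * ∑' n, μ n = 1 - γ := by
    rw [hμ', htsum, hγdef]; ring
  -- asymptotics of moments
  have hq1 : ∀ᵐ y ∂q, y ≠ 1 := by
    have := ae_lt_top' (μ := q) (f := fun y : ℝ => (ENNReal.ofReal (1 - y))⁻¹) (by fun_prop) hfin
    filter_upwards [this] with y hy h1
    simp [h1] at hy
  have hΓ : 0 < Real.Gamma α := Real.Gamma_pos_of_pos (by linarith)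
  have hu : Tendsto (fun n : ℕ => (n:ℝ) ^ α * μ n) atTop (𝓝 (α * Real.Gamma α)) := by
    have h := km_asym q α hα htail (fun n => (n:ℝ)) (fun s => s) ?_ ?_
    · rw [km_gamma α hα] at h
      refine h.congr' ?_
      filter_upwards [eventually_ge_atTop 1] with n hn
      have : (n:ℝ) ≠ 0 := by positivity
      rw [div_self this, sub_self, hμ]
      congr 1
      refine setIntegral_eq_integral_of_ae_compl_eq_zero ?_
      filter_upwards [hqae, hq1] with y hy hy1 hyn
      have : y = 0 := by
        by_contra hne
        exact hyn ⟨lt_of_le_of_ne hy.1 (Ne.symm hne), lt_of_le_of_ne hy.2 hy1⟩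
      rw [this, zero_pow (by omega)]
    · filter_upwards [eventually_ge_atTop 1] with n hn
      exact ⟨by positivity, le_rfl⟩
    · intro s hs
      refine tendsto_const_nhds.congr' ?_
      filter_upwards [eventually_ge_atTop ⌈s⌉₊] with n hns
      rw [min_eq_left]
      exact (Nat.le_ceil s).trans (by exact_mod_cast hns)
  have hcpos : 0 < α * Real.Gamma α := by positivity
  obtain ⟨⟨D, hD⟩, hr⟩ := km_regular μ α _ (by linarith) hcpos hμpos hu
  -- renewal theorem
  have harec : ∀ n, 1 ≤ n → a n = m n + β * ∑ i ∈ Finset.range n, μ i * a (n - i) := by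
    intro n hn
    have h := haF n hn Set.univ MeasurableSet.univ
    have := (hmod n).1
    simp only [Measure.restrict_univ, probReal_univ, mul_one, ← hm, ← hμ] at h
    exact h
  obtain ⟨hsa, hlim⟩ := km_renewal a m μ D β γ hβ0 hγpos hann ha0 hm0 hμpos hsμ hsum hD hr hmdom harec
  set A := ∑' n, a n with hA
  have hApos : 0 < A := hsa.tsum_pos hann 1 (hapos 1 le_rfl)
  -- local moments
  set G : ℕ → ℕ → ℝ := fun n i => ∫ y in Set.Ioo (1 - x / (n:ℝ)) 1, y ^ i ∂q with hG
  have hG0 : ∀ n i, 0 ≤ G n i := fun n i => 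
    integral_nonneg_of_ae (ae_restrict_of_ae (hqnn i))
  have hGμ : ∀ n i, G n i ≤ μ i := fun n i => by
    rw [hμ]
    exact setIntegral_le_integral (km_int q hqsupp i) (hqnn i)
  obtain ⟨K, hK, hKb⟩ := km_tailbound q α hα htail
  have hGz : ∀ i, Tendsto (fun n => G n i) atTop (𝓝 0) := by
    intro i
    have h1 : Tendsto (fun n : ℕ => K * (x / (n:ℝ)) ^ α) atTop (𝓝 0) := by
      have := ((tendsto_const_div_atTop_nhds_zero_nat x).rpow_const (p := α)
        (Or.inr (by linarith))).const_mul K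
      rwa [Real.zero_rpow (by linarith), mul_zero] at this
    refine squeeze_zero' (Eventually.of_forall fun n => hG0 n i) ?_ h1
    filter_upwards [eventually_ge_atTop 1] with n hn
    refine le_trans ?_ (hKb (x / n) (by positivity))
    have : q.real (Set.Ioo (1 - x / (n:ℝ)) 1) = ∫ y in Set.Ioo (1 - x / (n:ℝ)) 1, (1:ℝ) ∂q := by simp
    rw [this]
    refine integral_mono_ae (km_int q hqsupp i).restrict (integrable_const _) ?_
    filter_upwards [ae_restrict_of_ae hqae] with y hy
    exact pow_le_one₀ hy.1 hy.2
  set l : ℝ := (∫ y in (0:ℝ)..x, y ^ (α - 1) * Real.exp (-y)) / Real.Gamma α with hldef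
  have hGn : Tendsto (fun n => G n n / μ n) atTop (𝓝 l) := by
    have h := km_asym q α hα htail (fun _ => x) (fun s => min s x) ?_ (fun s hs => tendsto_const_nhds)
    · rw [km_incgamma α hα x hx] at h
      have h2 := h.div hu hcpos.ne'
      rw [mul_div_mul_left _ _ (by linarith)] at h2
      refine h2.congr' ?_
      filter_upwards [eventually_ge_atTop 1] with n hn
      have e1 : (0:ℝ) < (n:ℝ) ^ α := by positivity
      simp only [Pi.div_apply, hG]
      rw [mul_div_mul_left _ _ e1.ne']
    · filter_upwards [eventually_ge_atTop ⌈x⌉₊] with n hn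
      exact ⟨hx, (Nat.le_ceil x).trans (by exact_mod_cast hn)⟩
  have hGj : ∀ j, Tendsto (fun n => G n (n - j) / μ n) atTop (𝓝 l) := by
    intro j
    have a2 : Tendsto (fun n : ℕ => 1 - x / (n:ℝ)) atTop (𝓝 1) := by
      simpa using (tendsto_const_div_atTop_nhds_zero_nat x).const_sub 1
    have h1 : Tendsto (fun n : ℕ => G n n / μ n / (1 - x / (n:ℝ)) ^ j) atTop (𝓝 l) := by
      have := hGn.div (a2.pow j) (by simp)
      rw [one_pow, div_one] at this
      exact this
    refine tendsto_of_tendsto_of_tendsto_of_le_of_le' hGn h1 ?_ ?_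
    · refine Eventually.of_forall fun n => ?_
      have := hμpos n
      show G n n / μ n ≤ _
      gcongr
      refine integral_mono_ae (km_int q hqsupp _).restrict (km_int q hqsupp _).restrict ?_
      filter_upwards [ae_restrict_of_ae hqae] with y hy
      exact pow_le_pow_of_le_one hy.1 hy.2 (Nat.sub_le _ _)
    · filter_upwards [a2.eventually (lt_mem_nhds zero_lt_one), eventually_ge_atTop j] with n hn hnj
      rw [div_right_comm]
      have := hμpos n
      gcongr
      rw [le_div_iff₀ (pow_pos hn j)]
      simp only [hG]
      rw [← integral_mul_const]
      refine integral_mono_ae ((km_int q hqsupp _).restrict.mul_const _) (km_int q hqsupp _).restrict ?_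
      filter_upwards [ae_restrict_mem measurableSet_Ioo] with y hy
      have hy0 : 0 < y := hn.trans hy.1
      calc y ^ (n - j) * (1 - x / (n:ℝ)) ^ j ≤ y ^ (n - j) * y ^ j := by
            gcongr
            exact hy.1.le
        _ = y ^ n := by rw [← pow_add]; congr 1; omega
  -- the two halves of the convolution
  have hH1 := km_H1 a μ D G l hann hsa hμpos hD hG0 hGμ hGj
  obtain ⟨B, hB⟩ := hlim.bddAbove_range
  have hBb : ∀ n, a n / μ n ≤ B := fun n => hB ⟨n, rfl⟩
  have hb0 : ∀ n, 0 ≤ a n / μ n := fun n => div_nonneg (hann n) (hμpos n).le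
  have hB0 : 0 ≤ B := (hb0 0).trans (hBb 0)
  have hH2 := km_H2 (fun n => a n / μ n) μ B D G (fun _ => 0) hb0 hBb hμpos hsμ hD hr hG0 hGμ (by
    intro i
    have := (hGz i).mul_const B
    rw [zero_mul] at this
    exact squeeze_zero (fun n => mul_nonneg (hG0 _ _) (hb0 _))
      (fun n => mul_le_mul_of_nonneg_left (hBb _) (hG0 _ _)) this)
  have e : ∀ k, a k / μ k * μ k = a k := fun k => div_mul_cancel₀ _ (hμpos k).ne'
  simp only [e, tsum_zero] at hH2
  have hconv : Tendsto (fun n => (∑ i ∈ Finset.range n, G n i * a (n - i)) / μ n) atTop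
      (𝓝 (l * A)) := by
    have := hH2.add hH1
    rw [zero_add] at this
    refine this.congr fun n => ?_
    exact (km_split n (G n) a (μ n) ha0).symm
  have hinit : Tendsto (fun n : ℕ => (∫ y in Set.Ioo (1 - x / (n:ℝ)) 1, y ^ n ∂p0) / μ n) atTop (𝓝 0) := by
    refine squeeze_zero (fun n => ?_) (fun n => ?_) hmdom
    · exact div_nonneg (integral_nonneg_of_ae (ae_restrict_of_ae (hpnn n))) (hμpos n).le
    · have := hμpos n
      gcongr
      rw [hm]
      exact setIntegral_le_integral (km_int p0 hp0supp n) (hpnn n)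
  have hfinal := (hinit.add (hconv.const_mul β)).div hlim (by positivity)
  have ev : (0 + β * (l * A)) / (β * A / γ) =
      γ / Real.Gamma α * ∫ y in (0:ℝ)..x, y ^ (α - 1) * Real.exp (-y) := by
    rw [hldef]; field_simp; ring
  rw [ev] at hfinal
  refine hfinal.congr' ?_
  filter_upwards [eventually_ge_atTop 1] with n hn
  have h := haF n hn (Set.Ioo (1 - x / (n:ℝ)) 1) measurableSet_Ioo
  have h1 := hapos n hn
  have h2 := hμpos n
  simp only [Pi.div_apply]
  rw [← mul_div_assoc, ← add_div]
  simp only [hG]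
  rw [← h, div_div_div_cancel_right₀ h2.ne', mul_div_cancel_left₀ _ h1.ne', measureReal_def]
end

section
/- Under the standing assumptions (tail condition with exponent α>1, moment dominance lim m_n/μ_n = 0, and condensation condition γ(β)>0), for every x>0 the contribution of the initial distribution to the representation of p_n vanishes in the scaling limit: lim_{n→∞} W_n^{-1} (1-β)^n ∫_{(1-x/n, 1]} y^n p_0(dy) = 0. -/
open MeasureTheory Filter Topology

theorem kg_ae (ν : Measure ℝ) (h : ν (Set.Icc (0:ℝ) 1)ᶜ = 0) :
    ∀ᵐ x ∂ν, 0 ≤ x ∧ x ≤ 1 := by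
  have : ∀ᵐ x ∂ν, x ∈ Set.Icc (0:ℝ) 1 := by
    rw [ae_iff]; exact h
  filter_upwards [this] with x hx using hx

theorem kg_int (ν : Measure ℝ) [IsFiniteMeasure ν] (h : ν (Set.Icc (0:ℝ) 1)ᶜ = 0) (k : ℕ) :
    Integrable (fun x : ℝ => x ^ k) ν := by
  refine Integrable.of_bound (by fun_prop) 1 ?_
  filter_upwards [kg_ae ν h] with x hx
  rw [Real.norm_eq_abs, abs_of_nonneg (pow_nonneg hx.1 k)]
  exact pow_le_one₀ hx.1 hx.2

theorem kg_nonneg (ν : Measure ℝ) (h : ν (Set.Icc (0:ℝ) 1)ᶜ = 0) (k : ℕ) :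
    0 ≤ ∫ x, x ^ k ∂ν := by
  refine integral_nonneg_of_ae ?_
  filter_upwards [kg_ae ν h] with x hx using pow_nonneg hx.1 k

theorem kg_wd_fin (ν : Measure ℝ) [IsFiniteMeasure ν] (h : ν (Set.Icc (0:ℝ) 1)ᶜ = 0) :
    IsFiniteMeasure (ν.withDensity fun x => ENNReal.ofReal x) := by
  refine isFiniteMeasure_withDensity_ofReal ?_
  have := (kg_int ν h 1).2
  simpa using this

theorem kg_wd_supp (ν : Measure ℝ) (h : ν (Set.Icc (0:ℝ) 1)ᶜ = 0) :
    (ν.withDensity fun x => ENNReal.ofReal x) (Set.Icc (0:ℝ) 1)ᶜ = 0 :=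
  withDensity_absolutelyContinuous _ _ h

theorem kg_wd_mom (ν : Measure ℝ) (h : ν (Set.Icc (0:ℝ) 1)ᶜ = 0) (k : ℕ) :
    ∫ x, x ^ k ∂(ν.withDensity fun x => ENNReal.ofReal x) = ∫ x, x ^ (k+1) ∂ν := by
  rw [integral_withDensity_eq_integral_toReal_smul (by fun_prop) (by simp)]
  refine integral_congr_ae ?_
  filter_upwards [kg_ae ν h] with x hx
  simp [ENNReal.toReal_ofReal hx.1, pow_succ, mul_comm]

theorem kg_step (q ν : Measure ℝ) [IsFiniteMeasure q] [IsFiniteMeasure ν]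
    (hq : q (Set.Icc (0:ℝ) 1)ᶜ = 0) (h : ν (Set.Icc (0:ℝ) 1)ᶜ = 0)
    (c β : ℝ) (hc : 0 ≤ c) (hβ : 0 ≤ β) (k : ℕ) :
    ∫ x, x ^ k ∂(ENNReal.ofReal c • (ν.withDensity fun x => ENNReal.ofReal x)
      + ENNReal.ofReal β • q) = c * ∫ x, x ^ (k+1) ∂ν + β * ∫ x, x ^ k ∂q := by
  haveI := kg_wd_fin ν h
  rw [integral_add_measure, integral_smul_measure, integral_smul_measure, kg_wd_mom ν h,
    ENNReal.toReal_ofReal hc, ENNReal.toReal_ofReal hβ, smul_eq_mul, smul_eq_mul]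
  · exact (kg_int _ (kg_wd_supp ν h) k).smul_measure (by simp)
  · exact (kg_int _ hq k).smul_measure (by simp)

theorem kg_mu_pos (q : Measure ℝ) [IsFiniteMeasure q]
    (hq : q (Set.Icc (0:ℝ) 1)ᶜ = 0) (α : ℝ)
    (htail : Tendsto (fun h : ℝ => (q (Set.Ioo (1 - h) 1)).toReal / h ^ α)
      (𝓝[>] (0:ℝ)) (𝓝 1)) (k : ℕ) : 0 < ∫ x, x ^ k ∂q := by
  have h1 := htail.eventually (lt_mem_nhds (zero_lt_one))
  have h2 : ∀ᶠ h : ℝ in 𝓝[>] (0:ℝ), h ∈ Set.Ioo (0:ℝ) 1 := Ioo_mem_nhdsGT one_pos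
  obtain ⟨h, hh, hh2⟩ := (h1.and h2).exists
  have hpos : q (Set.Ioo (1 - h) 1) ≠ 0 := by
    intro h0
    simp [h0] at hh
  rw [integral_pos_iff_support_of_nonneg_ae ?_ (kg_int q hq k)]
  · refine lt_of_lt_of_le (pos_iff_ne_zero.2 hpos) (measure_mono ?_)
    intro x hx
    have : 0 < x := by linarith [hx.1, hh2.2]
    exact (pow_pos this k).ne'
  · filter_upwards [kg_ae q hq] with x hx using pow_nonneg hx.1 k

/-- Under the standing assumptions of Kingman's model, for every `x > 0` the contribution
of the initial distribution to the representation of `p n` vanishes in the scaling limit: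
`(W n)⁻¹ (1-β)^n ∫_{(1-x/n,1]} y^n p0(dy) → 0`. -/
theorem kingman_initial_term_vanishes
    (q p0 : Measure ℝ) [IsProbabilityMeasure q] [IsProbabilityMeasure p0]
    (hqsupp : q (Set.Icc (0:ℝ) 1)ᶜ = 0) (hp0supp : p0 (Set.Icc (0:ℝ) 1)ᶜ = 0)
    (β : ℝ) (hβ0 : 0 < β) (hβ1 : β < 1)
    (hmean : 0 < ∫ x, x ∂p0)
    (p : ℕ → Measure ℝ) (hp0 : p 0 = p0)
    (w : ℕ → ℝ) (hw : ∀ n, w n = ∫ x, x ∂(p n))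
    (hrec : ∀ n, p (n + 1)
        = ENNReal.ofReal ((1 - β) / w n) • ((p n).withDensity fun x => ENNReal.ofReal x)
          + ENNReal.ofReal β • q)
    (W : ℕ → ℝ) (hW0 : W 0 = 1) (hWs : ∀ n, W (n + 1) = W n * w (n + 1))
    (m μ : ℕ → ℝ)
    (hm : ∀ n, m n = ∫ x, x ^ n ∂p0)
    (hμ : ∀ n, μ n = ∫ x, x ^ n ∂q)
    (α : ℝ) (hα : 1 < α)
    (htail : Tendsto (fun h : ℝ => (q (Set.Ioo (1 - h) 1)).toReal / h ^ α)
      (𝓝[>] (0:ℝ)) (𝓝 1))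
    (hmdom : Tendsto (fun n => m n / μ n) atTop (𝓝 0))
    (hfin : ∫⁻ x, (ENNReal.ofReal (1 - x))⁻¹ ∂q ≠ ⊤)
    (γ : ℝ) (hγdef : γ = 1 - β * (∫⁻ x, (ENNReal.ofReal (1 - x))⁻¹ ∂q).toReal)
    (hγpos : 0 < γ) :
    ∀ x : ℝ, 0 < x →
      Tendsto (fun n : ℕ =>
          (W n)⁻¹ * (1 - β) ^ n * ∫ y in Set.Ioc (1 - x / (n:ℝ)) 1, y ^ n ∂p0)
        atTop (𝓝 0) := by
  intro x hx
  have hb : 0 < 1 - β := by linarith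
  have hμpos : ∀ k, 0 < μ k := fun k => by
    rw [hμ]; exact kg_mu_pos q hqsupp α htail k
  have key : ∀ n, IsFiniteMeasure (p n) ∧ p n (Set.Icc (0:ℝ) 1)ᶜ = 0 ∧ 0 < w n := by
    intro n
    induction n with
    | zero =>
      rw [hw, hp0]
      exact ⟨inferInstance, hp0supp, hmean⟩
    | succ n ih =>
      obtain ⟨i1, i2, i3⟩ := ih
      haveI := kg_wd_fin (p n) i2
      have hc : 0 ≤ (1 - β) / w n := by positivity
      refine ⟨?_, ?_, ?_⟩
      · rw [hrec]
        haveI := Measure.smul_finite ((p n).withDensity fun x => ENNReal.ofReal x) (ENNReal.ofReal_ne_top (r := (1 - β) / w n))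
        haveI := Measure.smul_finite q (ENNReal.ofReal_ne_top (r := β))
        infer_instance
      · rw [hrec]
        simp [kg_wd_supp (p n) i2, hqsupp]
      · have h1 := kg_step q (p n) hqsupp i2 _ β hc hβ0.le 1
        rw [← hrec, ← hμ] at h1
        simp only [pow_one] at h1
        rw [hw, h1]
        have := kg_nonneg (p n) i2 (1+1)
        have := hμpos 1
        positivity
  have hmom : ∀ n k, ∫ x, x ^ k ∂(p (n+1)) =
      (1 - β) / w n * ∫ x, x ^ (k+1) ∂(p n) + β * μ k := by
    intro n k
    obtain ⟨i1, i2, i3⟩ := key n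
    rw [hrec, hμ]
    exact kg_step q (p n) hqsupp i2 _ β (by positivity) hβ0.le k
  have hWpos : ∀ n, 0 < W n := by
    intro n
    induction n with
    | zero => rw [hW0]; exact one_pos
    | succ n ih => rw [hWs]; exact mul_pos ih (key (n+1)).2.2
  have hlow : ∀ n k, β * (1 - β) ^ n * μ (n + k) ≤ W n * ∫ x, x ^ k ∂(p (n+1)) := by
    intro n
    induction n with
    | zero =>
      intro k
      have := kg_nonneg (p 0) (key 0).2.1 (k+1)
      have h3 := (key 0).2.2
      have h4 : 0 ≤ (1 - β) / w 0 * ∫ x, x ^ (k+1) ∂(p 0) := by positivity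
      rw [hW0, hmom]
      simp only [pow_zero, zero_add]
      linarith
    | succ n ih =>
      intro k
      have h1 := ih (k+1)
      have h3 := (key (n+1)).2.2
      have hWn := hWpos n
      have hk := hμpos k
      rw [hmom, hWs]
      have e : W n * w (n+1) * ((1 - β) / w (n+1) * ∫ x, x ^ (k+1) ∂(p (n+1)) + β * μ k)
        = (1 - β) * (W n * ∫ x, x ^ (k+1) ∂(p (n+1))) + W n * w (n+1) * (β * μ k) := by
        field_simp
      rw [e, show n + 1 + k = n + (k + 1) by ring]
      have h5 : 0 ≤ W n * w (n+1) * (β * μ k) := by positivity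
      have h6 := mul_le_mul_of_nonneg_left h1 hb.le
      calc _ = (1 - β) * (β * (1 - β) ^ n * μ (n + (k + 1))) := by ring
        _ ≤ _ := by linarith
  have hWlow : ∀ n, β * (1 - β) ^ n * μ (n + 1) ≤ W (n+1) := by
    intro n
    have := hlow n 1
    simp only [pow_one] at this
    rwa [hWs, hw]
  have hlim : Tendsto (fun n => (1 - β) / β * (m n / μ n)) atTop (𝓝 0) := by
    simpa using hmdom.const_mul ((1 - β) / β)
  have hnn : ∀ᵐ y ∂p0, ∀ n : ℕ, 0 ≤ y ^ n := by
    filter_upwards [kg_ae p0 hp0supp] with y hy n using pow_nonneg hy.1 n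
  refine squeeze_zero' (Eventually.of_forall fun n => ?_) ?_ hlim
  · have : 0 ≤ ∫ y in Set.Ioc (1 - x / (n:ℝ)) 1, y ^ n ∂p0 :=
      integral_nonneg_of_ae (ae_restrict_of_ae (by filter_upwards [hnn] with y hy using hy n))
    have := hWpos n
    positivity
  · filter_upwards [eventually_ge_atTop 1] with n hn
    obtain ⟨n, rfl⟩ : ∃ k, n = k + 1 := ⟨n - 1, by omega⟩
    have hI : ∫ y in Set.Ioc (1 - x / ((n+1 : ℕ):ℝ)) 1, y ^ (n+1) ∂p0 ≤ m (n+1) := by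
      rw [hm]
      exact setIntegral_le_integral (kg_int p0 hp0supp (n+1))
        (by filter_upwards [hnn] with y hy using hy (n+1))
    have hmn : 0 ≤ m (n+1) := by rw [hm]; exact kg_nonneg p0 hp0supp _
    have hWn := hWpos (n+1)
    have hmu := hμpos (n+1)
    have hl := hWlow n
    calc _ ≤ (W (n+1))⁻¹ * (1 - β) ^ (n+1) * m (n+1) :=
          mul_le_mul_of_nonneg_left hI (by positivity)
      _ ≤ (β * (1 - β) ^ n * μ (n + 1))⁻¹ * (1 - β) ^ (n+1) * m (n+1) := by
          gcongr
      _ = _ := by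
          field_simp
          ring
end
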